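/- Let δ ∈ (0,1), ε > 0 and c₀ > 0 be fixed. For all X, T ≥ 1, one has #𝒮^{(1)}(X,T) ≪ (XT)^ε · (X^{3/4} + X^{5/12 + δ/2}T + X^{1/4 + δ}T² + X^{−1/12 + 3δ/2}T³), with implied constant depending only on δ, ε and c₀. -/

import Mathlib

/-- The set `𝒮(X, T)` of quintuples `(A, B, w, y, q)` with `y² = w³ + Awq⁴ + Bq⁶`, `4|A|³ ≤ X`,
`27B² ≤ X`, `|w| ≤ c₀ T² X^δ`, `q² ≤ c₀ T² X^δ`, `y ≥ 1`, `q ≥ 1` and `gcd(w, q) = 1`. -/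
def Sset (c₀ δ X T : ℝ) : Set (ℤ × ℤ × ℤ × ℤ × ℤ) :=
  {t | t.2.2.2.1 ≥ 1 ∧ t.2.2.2.2 ≥ 1 ∧
    t.2.2.2.1 ^ 2 = t.2.2.1 ^ 3 + t.1 * t.2.2.1 * t.2.2.2.2 ^ 4 + t.2.1 * t.2.2.2.2 ^ 6 ∧
    (4 * |t.1| ^ 3 : ℝ) ≤ X ∧ (27 * t.2.1 ^ 2 : ℝ) ≤ X ∧
    (|t.2.2.1| : ℝ) ≤ c₀ * T ^ 2 * X ^ δ ∧ ((t.2.2.2.2 : ℝ)) ^ 2 ≤ c₀ * T ^ 2 * X ^ δ ∧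
    Int.gcd t.2.2.1 t.2.2.2.2 = 1}

/-- The subset `𝒮^{(1)}(X, T)` where moreover `|w| > X^{1/6} q²`. -/
def Sset1 (c₀ δ X T : ℝ) : Set (ℤ × ℤ × ℤ × ℤ × ℤ) :=
  {t ∈ Sset c₀ δ X T | X ^ ((1 : ℝ) / 6) * (t.2.2.2.2 : ℝ) ^ 2 < (|t.2.2.1| : ℝ)}

/-- The subset `𝒮^{(2)}(X, T) = 𝒮(X, T) ∖ 𝒮^{(1)}(X, T)`. -/
def Sset2 (c₀ δ X T : ℝ) : Set (ℤ × ℤ × ℤ × ℤ × ℤ) := Sset c₀ δ X T \ Sset1 c₀ δ X T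

/-- A finite set of integers in an interval of length `D`, any two of which are congruent modulo
`m` up to a factor `2`, has at most `1 + 2 * D / m` elements. -/
lemma card_le_of_dvd_two_mul_sub (S : Finset ℤ) (m : ℤ) (hm : 0 < m) (D : ℝ) (hD : 0 ≤ D)
    (hdvd : ∀ a ∈ S, ∀ b ∈ S, m ∣ 2 * (a - b))
    (hle : ∀ a ∈ S, ∀ b ∈ S, |(a : ℝ) - b| ≤ D) : (S.card : ℝ) ≤ 1 + 2 * D / m := by
  have hm' : (0 : ℝ) < m := by exact_mod_cast hm
  rcases S.eq_empty_or_nonempty with rfl | hne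
  · simp only [Finset.card_empty, Nat.cast_zero]
    positivity
  set a₀ := S.min' hne with ha₀
  have ha₀S : a₀ ∈ S := S.min'_mem hne
  have key : S.card ≤ (Finset.Icc (0 : ℤ) ⌊2 * D / m⌋).card := by
    refine Finset.card_le_card_of_injOn (fun a => 2 * (a - a₀) / m) ?_ ?_
    · intro a ha
      have h1 : a₀ ≤ a := S.min'_le a ha
      have h2 := hle a ha a₀ ha₀S
      obtain ⟨k, hk⟩ := hdvd a ha a₀ ha₀S
      have h3 : 2 * (a - a₀) / m = k := by rw [hk]; exact Int.mul_ediv_cancel_left _ hm.ne'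
      simp only [Finset.coe_Icc, Set.mem_Icc, h3]
      constructor
      · by_contra hneg
        push Not at hneg
        nlinarith
      · rw [Int.le_floor, le_div_iff₀ hm']
        have h4 : (2 : ℝ) * (a - a₀) = m * k := by exact_mod_cast hk
        have := (abs_le.mp h2).2
        nlinarith
    · intro a ha b hb hab
      obtain ⟨k, hk⟩ := hdvd a ha a₀ ha₀S
      obtain ⟨l, hl⟩ := hdvd b hb a₀ ha₀S
      simp only [hk, hl, Int.mul_ediv_cancel_left _ hm.ne'] at hab
      subst hab
      linarith
  have h0 : (0 : ℤ) ≤ ⌊2 * D / m⌋ := Int.floor_nonneg.mpr (by positivity)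
  rw [Int.card_Icc] at key
  have h1 : (S.card : ℤ) ≤ ⌊2 * D / m⌋ + 1 := by omega
  have h2 : (S.card : ℝ) ≤ ⌊2 * D / m⌋ + 1 := by exact_mod_cast h1
  linarith [Int.floor_le (2 * D / m)]

lemma card_le_mul_card_of_fiber_le {α β : Type*} [DecidableEq β] (s : Finset α) (t : Finset β)
    (f : α → β) (hf : ∀ a ∈ s, f a ∈ t) (r : ℝ)
    (hr : ∀ b ∈ t, ((s.filter (fun a => f a = b)).card : ℝ) ≤ r) :
    (s.card : ℝ) ≤ t.card * r := by
  rw [Finset.card_eq_sum_card_fiberwise hf, Nat.cast_sum, ← nsmul_eq_mul]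
  exact Finset.sum_le_card_nsmul _ _ _ hr

/-- In an interval of length `D` there are at most `τ(M) * (1 + 2 * D / M)` square roots modulo `M`
of a fixed unit. -/
lemma card_sqrt_mod_le (S : Finset ℤ) (M : ℕ) (hM : 0 < M) (a : ℤ) (D : ℝ) (hD : 0 ≤ D)
    (hS : ∀ y ∈ S, (M : ℤ) ∣ y ^ 2 - a) (hcop : ∀ y ∈ S, IsCoprime y (M : ℤ))
    (hle : ∀ y ∈ S, ∀ z ∈ S, |(y : ℝ) - z| ≤ D) :
    (S.card : ℝ) ≤ M.divisors.card * (1 + 2 * D / M) := by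
  rcases S.eq_empty_or_nonempty with rfl | ⟨x, hx⟩
  · simp only [Finset.card_empty, Nat.cast_zero]
    positivity
  refine card_le_mul_card_of_fiber_le S M.divisors (fun y => Int.gcd (y - x) M) ?_ _ ?_
  · intro y _
    rw [Nat.mem_divisors]
    exact ⟨by exact_mod_cast Int.gcd_dvd_right (y - x) (M : ℤ), hM.ne'⟩
  · intro d hd
    obtain ⟨e, he⟩ := (Nat.mem_divisors.mp hd).1
    have hd0 : 0 < d := Nat.pos_of_mem_divisors hd
    have hdvd1 : ∀ y ∈ S, Int.gcd (y - x) M = d → (d : ℤ) ∣ y - x := by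
      rintro y - rfl
      exact Int.gcd_dvd_left _ _
    have hdvd2 : ∀ y ∈ S, Int.gcd (y - x) M = d → (e : ℤ) ∣ y + x := by
      intro y hy hyd
      obtain ⟨k, hk⟩ := hdvd1 y hy hyd
      have h1 : (M : ℤ) ∣ (y - x) * (y + x) := by
        have h2 : (y - x) * (y + x) = (y ^ 2 - a) - (x ^ 2 - a) := by ring
        rw [h2]
        exact dvd_sub (hS y hy) (hS x hx)
      have hd0' : (d : ℤ) ≠ 0 := by exact_mod_cast hd0.ne'
      have hke : IsCoprime k (e : ℤ) := by
        rw [Int.isCoprime_iff_gcd_eq_one]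
        have h2 : Int.gcd ((d : ℤ) * k) ((d : ℤ) * e) = d := by
          rw [← hk]
          rw [he] at hyd
          exact_mod_cast hyd
        rw [Int.gcd_mul_left] at h2
        simp only [Int.natAbs_natCast] at h2
        exact Nat.eq_of_mul_eq_mul_left hd0 (by simpa using h2)
      rw [he, hk, Nat.cast_mul, mul_assoc] at h1
      exact hke.symm.dvd_of_dvd_mul_left ((mul_dvd_mul_iff_left hd0').mp h1)
    have := card_le_of_dvd_two_mul_sub (S.filter (fun y => Int.gcd (y - x) M = d)) M
      (by exact_mod_cast hM) D hD ?_ ?_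
    · simpa using this
    · intro y hy z hz
      rw [Finset.mem_filter] at hy hz
      have h1 : (d : ℤ) ∣ y - z := by
        have := dvd_sub (hdvd1 y hy.1 hy.2) (hdvd1 z hz.1 hz.2)
        simpa using this
      have h2 : (e : ℤ) ∣ y - z := by
        have := dvd_sub (hdvd2 y hy.1 hy.2) (hdvd2 z hz.1 hz.2)
        simpa using this
      have hMde : (M : ℤ) = d * e := by exact_mod_cast he
      obtain ⟨u, v, huv⟩ := hcop y hy.1
      obtain ⟨k, hk⟩ := hdvd1 y hy.1 hy.2
      obtain ⟨l, hl⟩ := hdvd2 y hy.1 hy.2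
      have e1 : (M : ℤ) ∣ e * (y - z) := by
        rw [hMde, mul_comm (d : ℤ)]; exact mul_dvd_mul_left _ h1
      have e2 : (M : ℤ) ∣ d * (y - z) := by
        rw [hMde]; exact mul_dvd_mul_left _ h2
      have e3 : 2 * (y - z) = (d * (y - z)) * (u * k) + (e * (y - z)) * (u * l)
          + M * (2 * v * (y - z)) := by
        linear_combination (-2 * (y - z)) * huv + (y - z) * u * hk + (y - z) * u * hl
      rw [e3]
      exact dvd_add (dvd_add (e2.mul_right _) (e1.mul_right _)) (dvd_mul_right _ _)
    · intro y hy z hz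
      exact hle y (Finset.mem_filter.mp hy).1 z (Finset.mem_filter.mp hz).1

/-- The divisor bound `τ(n) ≪ n ^ ε`. -/
lemma exists_card_divisors_le_rpow (ε : ℝ) (hε : 0 < ε) :
    ∃ C : ℝ, 0 < C ∧ ∀ n : ℕ, n ≠ 0 → (n.divisors.card : ℝ) ≤ C * (n : ℝ) ^ ε := by
  set K : ℝ := max 1 (1 / (ε * Real.log 2)) with hK
  have hl2 : 0 < Real.log 2 := Real.log_pos (by norm_num)
  have hK1 : 1 ≤ K := le_max_left _ _
  have hK2 : 1 ≤ K * (ε * Real.log 2) := by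
    rw [← div_le_iff₀ (by positivity)]
    exact le_max_right _ _
  set P : ℕ := ⌈(2 : ℝ) ^ (1 / ε)⌉₊ with hP
  have hprime : ∀ p : ℕ, p.Prime → ∀ a : ℕ,
      ((a + 1 : ℕ) : ℝ) ≤ (if p < P then K else 1) * ((p : ℝ) ^ a) ^ ε := by
    intro p hp a
    have hp2 : (2 : ℝ) ≤ p := by exact_mod_cast hp.two_le
    have hcomm : ((p : ℝ) ^ a) ^ ε = ((p : ℝ) ^ ε) ^ a := by
      rw [← Real.rpow_natCast, ← Real.rpow_natCast, ← Real.rpow_mul (by positivity),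
        ← Real.rpow_mul (by positivity), mul_comm]
    push_cast
    split_ifs with hpP
    · have h1 : ((2 : ℝ) ^ a) ^ ε ≤ ((p : ℝ) ^ a) ^ ε := by gcongr
      have h2 : ((2 : ℝ) ^ a) ^ ε = Real.exp (ε * Real.log 2 * a) := by
        rw [← Real.rpow_natCast, ← Real.rpow_mul (by norm_num), Real.rpow_def_of_pos (by norm_num)]
        ring_nf
      have h3 := Real.add_one_le_exp (ε * Real.log 2 * a)
      rw [← h2] at h3
      have h4 : (0 : ℝ) ≤ a := by positivity
      calc (a : ℝ) + 1 ≤ K * (ε * Real.log 2 * a + 1) := by nlinarith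
        _ ≤ _ := by gcongr; linarith
    · push Not at hpP
      rw [one_mul, hcomm]
      have h1 : (2 : ℝ) ^ (1 / ε) ≤ p := (Nat.le_ceil _).trans (by exact_mod_cast hpP)
      have h2 : (2 : ℝ) ≤ (p : ℝ) ^ ε := by
        calc (2 : ℝ) = ((2 : ℝ) ^ (1 / ε)) ^ ε := by
              rw [← Real.rpow_mul (by norm_num), one_div_mul_cancel hε.ne', Real.rpow_one]
          _ ≤ _ := by gcongr
      have h3 : (a : ℝ) + 1 ≤ 2 ^ a := by exact_mod_cast Nat.lt_two_pow_self (n := a)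
      exact h3.trans (by gcongr)
  refine ⟨K ^ P, by positivity, fun n hn => ?_⟩
  rw [Nat.card_divisors hn, Nat.cast_prod]
  calc ∏ p ∈ n.primeFactors, ((n.factorization p + 1 : ℕ) : ℝ)
      ≤ ∏ p ∈ n.primeFactors, ((if p < P then K else 1) * ((p : ℝ) ^ n.factorization p) ^ ε) :=
        Finset.prod_le_prod (fun _ _ => by positivity)
          fun p hp => hprime p (Nat.prime_of_mem_primeFactors hp) _
    _ = (∏ p ∈ n.primeFactors, (if p < P then K else 1)) *
          (∏ p ∈ n.primeFactors, (p : ℝ) ^ n.factorization p) ^ ε := by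
        rw [Finset.prod_mul_distrib, Real.finsetProd_rpow]
        intro p _
        positivity
    _ ≤ K ^ P * (n : ℝ) ^ ε := by
        have h1 : ∏ p ∈ n.primeFactors, (p : ℝ) ^ n.factorization p = n := by
          exact_mod_cast Nat.prod_factorization_pow_eq_self hn
        rw [h1]
        gcongr
        rw [Finset.prod_ite, Finset.prod_const, Finset.prod_const_one, mul_one]
        refine pow_le_pow_right₀ hK1 ?_
        calc (n.primeFactors.filter (· < P)).card ≤ (Finset.range P).card :=
              Finset.card_le_card fun p hp => by
                simpa using (Finset.mem_filter.mp hp).2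
          _ = P := Finset.card_range P

/-- The harmonic sum up to `n` is `≪ n ^ ε`. -/
lemma exists_sum_inv_le_rpow (ε : ℝ) (hε : 0 < ε) :
    ∃ C : ℝ, 0 < C ∧ ∀ n : ℕ, 1 ≤ n →
      ∑ i ∈ Finset.Icc 1 n, ((i : ℝ))⁻¹ ≤ C * (n : ℝ) ^ ε := by
  refine ⟨1 + 1 / ε, by positivity, fun n hn => ?_⟩
  have h1 := harmonic_le_one_add_log n
  rw [harmonic_eq_sum_Icc] at h1
  push_cast at h1
  have h2 := Real.log_le_rpow_div (x := (n : ℝ)) (by positivity) hε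
  have h3 : (1 : ℝ) ≤ (n : ℝ) ^ ε := Real.one_le_rpow (by exact_mod_cast hn) hε.le
  calc _ ≤ 1 + Real.log n := h1
    _ ≤ (n : ℝ) ^ ε + (n : ℝ) ^ ε / ε := by gcongr
    _ = _ := by ring

/-- The bound on `A` from `4 |A|³ ≤ X`, where `X = b ^ 12`. -/
lemma abs_le_of_four_mul_pow_le {A b : ℝ} (hb : 0 < b) (hA : 4 * |A| ^ 3 ≤ b ^ 12) :
    |A| ≤ 0.64 * b ^ 4 := by
  by_contra! h
  have h1 : (0.64 * b ^ 4) ^ 3 < |A| ^ 3 := by gcongr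
  have h2 : 0 < b ^ 12 := by positivity
  nlinarith

/-- The bound on `B` from `27 B² ≤ X`, where `X = b ^ 12`. -/
lemma abs_le_of_mul_sq_le {B b : ℝ} (hb : 0 < b) (hB : 27 * B ^ 2 ≤ b ^ 12) :
    |B| ≤ 0.2 * b ^ 6 := by
  by_contra! h
  have h1 : (0.2 * b ^ 6) ^ 2 < |B| ^ 2 := by gcongr
  have h2 : 0 < b ^ 12 := by positivity
  rw [sq_abs] at h1
  nlinarith

/-- When `|w| > b² q²`, the terms `A w q⁴ + B q⁶` are dominated by `w³`. -/
lemma abs_lower_terms_le {A B w q b : ℝ} (hb : 0 < b) (hA : 4 * |A| ^ 3 ≤ b ^ 12)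
    (hB : 27 * B ^ 2 ≤ b ^ 12) (hw : b ^ 2 * q ^ 2 < |w|) :
    |A * w * q ^ 4 + B * q ^ 6| ≤ 0.84 * (q ^ 4 * b ^ 4 * |w|) := by
  have hA' := abs_le_of_four_mul_pow_le hb hA
  have hB' := abs_le_of_mul_sq_le hb hB
  calc |A * w * q ^ 4 + B * q ^ 6| ≤ |A * w * q ^ 4| + |B * q ^ 6| := abs_add_le _ _
    _ = |A| * |w| * q ^ 4 + |B| * q ^ 6 := by
        rw [abs_mul, abs_mul, abs_mul, abs_of_nonneg (show 0 ≤ q ^ 4 by positivity),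
          abs_of_nonneg (show 0 ≤ q ^ 6 by positivity)]
    _ ≤ (0.64 * b ^ 4) * |w| * q ^ 4 + (0.2 * b ^ 6) * q ^ 6 := by gcongr
    _ = 0.64 * (q ^ 4 * b ^ 4 * |w|) + 0.2 * (q ^ 4 * b ^ 4 * (b ^ 2 * q ^ 2)) := by ring
    _ ≤ 0.64 * (q ^ 4 * b ^ 4 * |w|) + 0.2 * (q ^ 4 * b ^ 4 * |w|) := by gcongr
    _ = _ := by ring

lemma pow_four_mul_le {w q b : ℝ} (hw : b ^ 2 * q ^ 2 < |w|) :
    q ^ 4 * b ^ 4 * |w| ≤ |w| ^ 3 := by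
  have h : (b ^ 2 * q ^ 2) ^ 2 ≤ |w| ^ 2 := by gcongr
  calc q ^ 4 * b ^ 4 * |w| = (b ^ 2 * q ^ 2) ^ 2 * |w| := by ring
    _ ≤ |w| ^ 2 * |w| := by gcongr
    _ = |w| ^ 3 := by ring

/-- Points on the curve with `|w| > b² q²` have positive `w`. -/
lemma pos_of_sq_eq {A B w y q b : ℝ} (hb : 0 < b) (hA : 4 * |A| ^ 3 ≤ b ^ 12)
    (hB : 27 * B ^ 2 ≤ b ^ 12) (hw : b ^ 2 * q ^ 2 < |w|)
    (h : y ^ 2 = w ^ 3 + A * w * q ^ 4 + B * q ^ 6) : 0 < w := by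
  by_contra! hneg
  have h1 := (abs_le.mp (abs_lower_terms_le hb hA hB hw)).2
  have h2 := pow_four_mul_le hw
  have h3 : 0 < |w| := lt_of_le_of_lt (by positivity) hw
  have h4 : 0 < |w| ^ 3 := by positivity
  have h5 : w ^ 3 = -|w| ^ 3 := by rw [abs_of_nonpos hneg]; ring
  nlinarith [sq_nonneg y]

/-- The possible values of `y` for given `w = s²` and `q` lie in a short interval. -/
lemma abs_sub_le_of_sq_eq {A B A' B' s y y' q b : ℝ} (hb : 0 < b) (hs : 0 < s)
    (hA : 4 * |A| ^ 3 ≤ b ^ 12) (hB : 27 * B ^ 2 ≤ b ^ 12)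
    (hA' : 4 * |A'| ^ 3 ≤ b ^ 12) (hB' : 27 * B' ^ 2 ≤ b ^ 12)
    (hw : b ^ 2 * q ^ 2 < s ^ 2) (hy : 0 < y) (hy' : 0 < y')
    (h : y ^ 2 = (s ^ 2) ^ 3 + A * s ^ 2 * q ^ 4 + B * q ^ 6)
    (h' : y' ^ 2 = (s ^ 2) ^ 3 + A' * s ^ 2 * q ^ 4 + B' * q ^ 6) :
    |y - y'| ≤ 3 * (q ^ 4 * b ^ 4 / s) := by
  have hs2 : |s ^ 2| = s ^ 2 := abs_of_pos (by positivity)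
  rw [← hs2] at hw
  have h1 := abs_lower_terms_le hb hA hB hw
  have h1' := abs_lower_terms_le hb hA' hB' hw
  have h2 := pow_four_mul_le hw
  rw [hs2] at h1 h1' h2
  have hlow : ∀ {z t : ℝ}, 0 < z → |t| ≤ 0.84 * (q ^ 4 * b ^ 4 * s ^ 2) →
      z ^ 2 = (s ^ 2) ^ 3 + t → 0.4 * s ^ 3 ≤ z := by
    intro z t hz ht hzt
    have h3 := (abs_le.mp ht).1
    refine le_of_sq_le_sq ?_ hz.le
    nlinarith
  have e1 := hlow hy h1 (by linarith)
  have e2 := hlow hy' h1' (by linarith)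
  have h3 : |y ^ 2 - y' ^ 2| ≤ 1.68 * (q ^ 4 * b ^ 4 * s ^ 2) := by
    rw [abs_le] at h1 h1' ⊢
    constructor <;> nlinarith
  have h4 : |y ^ 2 - y' ^ 2| = |y - y'| * (y + y') := by
    rw [sq_sub_sq, abs_mul, abs_of_pos (show 0 < y + y' by positivity), mul_comm]
  have h5 : |y - y'| * (0.8 * s ^ 3) ≤ 1.68 * (q ^ 4 * b ^ 4 * s ^ 2) := by
    refine le_trans ?_ (h4 ▸ h3)
    gcongr
    linarith
  rw [← mul_div_assoc, le_div_iff₀ hs]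
  have h6 : 0 < s ^ 2 := by positivity
  refine le_of_mul_le_mul_right ?_ h6
  have h7 : 0 ≤ q ^ 4 * b ^ 4 * s ^ 2 := by positivity
  nlinarith

/-- The number of `(A, B, y)` for given `w` and `q` with `w > b² q²`, where `b = X ^ (1 / 12)`. -/
lemma card_fiber_le (F : Finset (ℤ × ℤ × ℤ × ℤ × ℤ)) (w q : ℕ) (b : ℝ) (hb : 0 < b)
    (hq : 1 ≤ q) (hw : b ^ 2 * (q : ℝ) ^ 2 < w) (hcop : Nat.Coprime w q)
    (hF : ∀ t ∈ F, t.2.2.2.1 ≥ 1 ∧ t.2.2.2.2 = q ∧ t.2.2.1 = w ∧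
      t.2.2.2.1 ^ 2 = t.2.2.1 ^ 3 + t.1 * t.2.2.1 * t.2.2.2.2 ^ 4 + t.2.1 * t.2.2.2.2 ^ 6 ∧
      4 * |(t.1 : ℝ)| ^ 3 ≤ b ^ 12 ∧ 27 * (t.2.1 : ℝ) ^ 2 ≤ b ^ 12) :
    (F.card : ℝ) ≤ (q ^ 4).divisors.card * (1 + 6 * (b ^ 4 / √w)) * (1 + 2 * (b ^ 6 / w)) := by
  have hq0 : (0 : ℝ) < q := by exact_mod_cast hq
  have hw0 : (0 : ℝ) < w := lt_of_le_of_lt (by positivity) hw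
  have hs0 : 0 < √(w : ℝ) := Real.sqrt_pos.mpr hw0
  have hss : √(w : ℝ) ^ 2 = w := Real.sq_sqrt hw0.le
  have hcopZ : IsCoprime (w : ℤ) (q : ℤ) := Nat.isCoprime_iff_coprime.mpr hcop
  have hwZ : (w : ℤ) ≠ 0 := by
    have : (w : ℝ) ≠ 0 := hw0.ne'
    exact_mod_cast this
  have hqZ : (0 : ℤ) < q := by exact_mod_cast hq
  have hY : ((F.image (fun t => t.2.2.2.1)).card : ℝ) ≤
      (q ^ 4).divisors.card * (1 + 6 * (b ^ 4 / √w)) := by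
    have := card_sqrt_mod_le (F.image (fun t => t.2.2.2.1)) (q ^ 4) (by positivity) ((w : ℤ) ^ 3)
      (3 * ((q : ℝ) ^ 4 * b ^ 4 / √w)) (by positivity) ?_ ?_ ?_
    · refine this.trans (le_of_eq ?_)
      push_cast
      field_simp
      ring
    · simp only [Finset.mem_image]
      rintro y ⟨⟨A, B, w', y', q'⟩, ht, rfl⟩
      obtain ⟨-, h2, h3, h4, -⟩ := hF _ ht
      dsimp only at h2 h3 h4 ⊢
      subst h2 h3
      exact ⟨A * w + B * q ^ 2, by rw [h4]; push_cast; ring⟩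
    · simp only [Finset.mem_image]
      rintro y ⟨⟨A, B, w', y', q'⟩, ht, rfl⟩
      obtain ⟨-, h2, h3, h4, -⟩ := hF _ ht
      dsimp only at h2 h3 h4 ⊢
      subst h2 h3
      push_cast
      refine IsCoprime.pow_right ?_
      have h5 : IsCoprime (y' ^ 2) (q : ℤ) := by
        have h6 : y' ^ 2 = (w : ℤ) ^ 3 + (q : ℤ) * (A * w * q ^ 3 + B * q ^ 5) := by
          rw [h4]; ring
        rw [h6]
        exact hcopZ.pow_left.add_mul_left_left _
      exact h5.of_isCoprime_of_dvd_left (dvd_pow_self _ two_ne_zero)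
    · simp only [Finset.mem_image]
      rintro y ⟨⟨A, B, w', y', q'⟩, ht, rfl⟩ z ⟨⟨A₁, B₁, w₁, y₁, q₁⟩, ht₁, rfl⟩
      obtain ⟨h1, h2, h3, h4, h5, h6⟩ := hF _ ht
      obtain ⟨g1, g2, g3, g4, g5, g6⟩ := hF _ ht₁
      dsimp only at h1 h2 h3 h4 h5 h6 g1 g2 g3 g4 g5 g6 ⊢
      subst h2 h3 g2 g3
      refine abs_sub_le_of_sq_eq hb hs0 h5 h6 g5 g6 (by rwa [hss])
        (by exact_mod_cast h1) (by exact_mod_cast g1) ?_ ?_ <;> rw [hss]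
      · exact_mod_cast h4
      · exact_mod_cast g4
  refine (card_le_mul_card_of_fiber_le F (F.image (fun t => t.2.2.2.1)) (fun t => t.2.2.2.1)
    (fun t ht => Finset.mem_image_of_mem _ ht) (1 + 2 * (b ^ 6 / w)) ?_).trans (by gcongr)
  intro y _
  set G := F.filter (fun t => t.2.2.2.1 = y) with hG
  have hGF : ∀ t ∈ G, t ∈ F ∧ t.2.2.2.1 = y := fun t ht => Finset.mem_filter.mp ht
  have hrel : ∀ t ∈ G, ∀ u ∈ G, (w : ℤ) * (t.1 - u.1) = (q : ℤ) ^ 2 * (u.2.1 - t.2.1) := by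
    rintro ⟨A, B, w', y', q'⟩ ht ⟨A₁, B₁, w₁, y₁, q₁⟩ hu
    have h0 := (hGF _ ht).2
    have g0 := (hGF _ hu).2
    obtain ⟨-, h2, h3, h4, -⟩ := hF _ (hGF _ ht).1
    obtain ⟨-, g2, g3, g4, -⟩ := hF _ (hGF _ hu).1
    dsimp only at h0 g0 h2 h3 h4 g2 g3 g4 ⊢
    subst h2 h3 g2 g3
    rw [h0] at h4
    rw [g0] at g4
    have hq4 : (q : ℤ) ^ 4 ≠ 0 := by positivity
    refine mul_left_cancel₀ hq4 ?_
    linear_combination g4 - h4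
  have hinj : Set.InjOn (fun t : ℤ × ℤ × ℤ × ℤ × ℤ => t.1) G := by
    intro t ht u hu htu
    have h := hrel t ht u hu
    obtain ⟨A, B, w', y', q'⟩ := t
    obtain ⟨A₁, B₁, w₁, y₁, q₁⟩ := u
    have h0 := (hGF _ ht).2
    have g0 := (hGF _ hu).2
    obtain ⟨-, h2, h3, -⟩ := hF _ (hGF _ ht).1
    obtain ⟨-, g2, g3, -⟩ := hF _ (hGF _ hu).1
    dsimp only at htu h h0 g0 h2 h3 g2 g3
    subst htu h2 h3 g2 g3
    have hq2 : (q : ℤ) ^ 2 ≠ 0 := by positivity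
    have h5 : B₁ - B = 0 := by
      have : (q : ℤ) ^ 2 * (B₁ - B) = 0 := by rw [← h]; ring
      exact (mul_eq_zero.mp this).resolve_left hq2
    have h6 : B₁ = B := by omega
    rw [h6, h0, g0]
  rw [← Finset.card_image_of_injOn hinj]
  have := card_le_of_dvd_two_mul_sub (G.image (fun t => t.1)) ((q : ℤ) ^ 2) (by positivity)
    ((q : ℝ) ^ 2 * (b ^ 6 / w)) (by positivity) ?_ ?_
  · refine this.trans (le_of_eq ?_)
    push_cast
    field_simp
  · simp only [Finset.mem_image]
    rintro _ ⟨t, ht, rfl⟩ _ ⟨u, hu, rfl⟩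
    refine Dvd.dvd.mul_left ?_ _
    refine (hcopZ.symm.pow_left (m := 2)).dvd_of_dvd_mul_left ?_
    exact ⟨_, hrel t ht u hu⟩
  · simp only [Finset.mem_image]
    rintro _ ⟨t, ht, rfl⟩ _ ⟨u, hu, rfl⟩
    have h : (w : ℝ) * (t.1 - u.1) = (q : ℝ) ^ 2 * (u.2.1 - t.2.1) := by
      exact_mod_cast hrel t ht u hu
    have hB := abs_le_of_mul_sq_le hb (hF t (hGF t ht).1).2.2.2.2.2
    have hB' := abs_le_of_mul_sq_le hb (hF u (hGF u hu).1).2.2.2.2.2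
    have h1 : |(u.2.1 : ℝ) - t.2.1| ≤ b ^ 6 := by
      have := abs_sub (u.2.1 : ℝ) t.2.1
      have hb6 : 0 < b ^ 6 := by positivity
      linarith
    have h2 : (w : ℝ) * |(t.1 : ℝ) - u.1| = (q : ℝ) ^ 2 * |(u.2.1 : ℝ) - t.2.1| := by
      rw [← abs_of_pos hw0, ← abs_mul, h, abs_mul, abs_of_nonneg (sq_nonneg (q : ℝ))]
    rw [← mul_div_assoc, le_div_iff₀ hw0, mul_comm, h2]
    gcongr

/-- The bound for one pair `(w, q)`, in a form that is summed over pairs by harmonic sums. -/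
lemma fiber_bound_le {w q b v : ℝ} (hb : 0 < b) (hq : 0 < q) (hw : b ^ 2 * q ^ 2 < w)
    (hwv : w ≤ v ^ 2) (hv : 0 < v) :
    (1 + 6 * (b ^ 4 / √w)) * (1 + 2 * (b ^ 6 / w)) ≤
      12 * (v ^ 3 / b + b ^ 3 * v ^ 2 + b ^ 5 * v + b ^ 9) * (q⁻¹ * w⁻¹) := by
  have hw0 : 0 < w := lt_of_le_of_lt (by positivity) hw
  obtain ⟨s, hs0, rfl⟩ : ∃ s, 0 < s ∧ w = s ^ 2 :=
    ⟨√w, Real.sqrt_pos.mpr hw0, (Real.sq_sqrt hw0.le).symm⟩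
  rw [Real.sqrt_sq hs0.le]
  have hsv : s ≤ v := le_of_sq_le_sq hwv hv.le
  have hbq : b * q ≤ s := le_of_sq_le_sq (by rw [mul_pow]; exact hw.le) hs0.le
  have hqb : q ≤ s / b := by rw [le_div_iff₀ hb]; linarith
  have h1 : q * (s ^ 2 + b ^ 4 * s + b ^ 6 + b ^ 10 / s) ≤
      v ^ 3 / b + b ^ 3 * v ^ 2 + b ^ 5 * v + b ^ 9 := by
    calc q * (s ^ 2 + b ^ 4 * s + b ^ 6 + b ^ 10 / s)
        ≤ s / b * (s ^ 2 + b ^ 4 * s + b ^ 6 + b ^ 10 / s) := by gcongr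
      _ = s ^ 3 / b + b ^ 3 * s ^ 2 + b ^ 5 * s + b ^ 9 := by field_simp
      _ ≤ _ := by gcongr
  calc (1 + 6 * (b ^ 4 / s)) * (1 + 2 * (b ^ 6 / s ^ 2))
      ≤ 12 * ((1 + b ^ 4 / s) * (1 + b ^ 6 / s ^ 2)) := by
        have : 0 < b ^ 4 / s := by positivity
        have : 0 < b ^ 6 / s ^ 2 := by positivity
        nlinarith
    _ = 12 * (q * (s ^ 2 + b ^ 4 * s + b ^ 6 + b ^ 10 / s)) * (q⁻¹ * (s ^ 2)⁻¹) := by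
        field_simp
        ring
    _ ≤ _ := by gcongr

/-- The count over all pairs `(q, w)`, in terms of `b = X ^ (1 / 12)` and `v = √(c₀ T² X ^ δ)`. -/
lemma card_le_of_subset_Sset1 {c₀ δ X T b v η C₁ C₂ : ℝ} (hb : 0 < b) (hv : 0 < v) (hη : 0 < η)
    (hbX : b ^ 12 = X) (hbX' : b ^ 2 = X ^ ((1 : ℝ) / 6)) (hvX : v ^ 2 = c₀ * T ^ 2 * X ^ δ)
    (hC₁0 : 0 < C₁) (hC₁ : ∀ n : ℕ, n ≠ 0 → (n.divisors.card : ℝ) ≤ C₁ * (n : ℝ) ^ η)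
    (hC₂ : ∀ n : ℕ, 1 ≤ n → ∑ i ∈ Finset.Icc 1 n, ((i : ℝ))⁻¹ ≤ C₂ * (n : ℝ) ^ η)
    (F : Finset (ℤ × ℤ × ℤ × ℤ × ℤ)) (hF : ∀ t ∈ F, t ∈ Sset1 c₀ δ X T) :
    (F.card : ℝ) ≤ 12 * C₁ * C₂ ^ 2 * (v ^ 2) ^ (6 * η) *
      (v ^ 3 / b + b ^ 3 * v ^ 2 + b ^ 5 * v + b ^ 9) := by
  set E : ℝ := v ^ 3 / b + b ^ 3 * v ^ 2 + b ^ 5 * v + b ^ 9 with hE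
  have hE0 : 0 < E := by positivity
  set n : ℕ := ⌊v ^ 2⌋₊ with hn
  have hpos : ∀ t ∈ F, (0 : ℤ) < t.2.2.1 := by
    rintro ⟨A, B, w, y, q⟩ ht
    obtain ⟨⟨-, -, h3, h4, h5, -⟩, h9⟩ := hF _ ht
    dsimp only at h3 h4 h5 h9 ⊢
    rw [← hbX'] at h9
    rw [← hbX] at h4 h5
    push_cast at h4 h9
    have h3' : (y : ℝ) ^ 2 = (w : ℝ) ^ 3 + A * w * q ^ 4 + B * q ^ 6 := by exact_mod_cast h3
    exact_mod_cast pos_of_sq_eq hb h4 h5 h9 h3'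
  have hmem : ∀ t ∈ F, (t.2.2.2.2.toNat, t.2.2.1.toNat) ∈
      Finset.Icc 1 n ×ˢ Finset.Icc 1 n := by
    intro t ht
    have hwpos := hpos t ht
    obtain ⟨A, B, w, y, q⟩ := t
    obtain ⟨⟨-, h2, -, -, -, h6, h7, -⟩, -⟩ := hF _ ht
    dsimp only at h2 h6 h7 hwpos ⊢
    rw [← hvX] at h6 h7
    lift w to ℕ using hwpos.le
    lift q to ℕ using (by omega)
    have h7' : (q : ℝ) ^ 2 ≤ v ^ 2 := by exact_mod_cast h7
    have h6' : (w : ℝ) ≤ v ^ 2 := by simpa using h6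
    have hq1 : 1 ≤ q := by exact_mod_cast h2
    have hq2 : (q : ℝ) ≤ (q : ℝ) ^ 2 := by exact_mod_cast Nat.le_self_pow two_ne_zero q
    simp only [Int.toNat_natCast, Finset.mem_product, Finset.mem_Icc]
    exact ⟨⟨hq1, Nat.le_floor (hq2.trans h7')⟩, ⟨by exact_mod_cast hwpos, Nat.le_floor h6'⟩⟩
  rcases F.eq_empty_or_nonempty with rfl | ⟨t₀, ht₀⟩
  · simp only [Finset.card_empty, Nat.cast_zero]
    positivity
  have hn1 : 1 ≤ n := by
    have := hmem t₀ ht₀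
    simp only [Finset.mem_product, Finset.mem_Icc] at this
    omega
  have hn0 : (0 : ℝ) < n := by exact_mod_cast hn1
  have hfib : ∀ p ∈ Finset.Icc 1 n ×ˢ Finset.Icc 1 n,
      ((F.filter (fun t => (t.2.2.2.2.toNat, t.2.2.1.toNat) = p)).card : ℝ) ≤
        12 * C₁ * (n : ℝ) ^ (4 * η) * E * ((p.1 : ℝ)⁻¹ * (p.2 : ℝ)⁻¹) := by
    rintro ⟨q, w⟩ hp
    simp only [Finset.mem_product, Finset.mem_Icc] at hp
    obtain ⟨⟨hq1, hqn⟩, hw1, hwn⟩ := hp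
    set G := F.filter (fun t => (t.2.2.2.2.toNat, t.2.2.1.toNat) = (q, w)) with hG
    have hGF : ∀ t ∈ G, t ∈ F ∧ t.2.2.2.2 = q ∧ t.2.2.1 = w := by
      intro t ht
      obtain ⟨h1, h2⟩ := Finset.mem_filter.mp ht
      rw [Prod.mk.injEq] at h2
      exact ⟨h1, by omega, by omega⟩
    rcases G.eq_empty_or_nonempty with h0 | ⟨u, hu⟩
    · rw [h0]
      simp only [Finset.card_empty, Nat.cast_zero]
      positivity
    have hqw : b ^ 2 * (q : ℝ) ^ 2 < w ∧ Nat.Coprime w q := by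
      obtain ⟨huF, h1, h2⟩ := hGF u hu
      obtain ⟨⟨-, -, -, -, -, -, -, h8⟩, h9⟩ := hF u huF
      rw [h1, h2] at h8 h9
      rw [← hbX'] at h9
      exact ⟨by simpa using h9, by simpa [Nat.Coprime] using h8⟩
    have hcard := card_fiber_le G w q b hb hq1 hqw.1 hqw.2 ?_
    · have hwv : (w : ℝ) ≤ v ^ 2 :=
        (show (w : ℝ) ≤ n by exact_mod_cast hwn).trans (Nat.floor_le (by positivity))
      have hq0 : (0 : ℝ) < q := by exact_mod_cast hq1
      have h1 := fiber_bound_le hb hq0 hqw.1 hwv hv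
      have h2 : ((q ^ 4).divisors.card : ℝ) ≤ C₁ * (n : ℝ) ^ (4 * η) := by
        refine (hC₁ (q ^ 4) (by positivity)).trans ?_
        have h3 : (n : ℝ) ^ (4 * η) = ((n : ℝ) ^ 4) ^ η := by
          rw [Real.rpow_mul hn0.le]
          norm_num
        rw [h3]
        push_cast
        gcongr
      calc (G.card : ℝ) ≤ (q ^ 4).divisors.card *
            ((1 + 6 * (b ^ 4 / √w)) * (1 + 2 * (b ^ 6 / w))) := by rw [← mul_assoc]; exact hcard
        _ ≤ (C₁ * (n : ℝ) ^ (4 * η)) * (12 * E * ((q : ℝ)⁻¹ * (w : ℝ)⁻¹)) := by gcongr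
        _ = _ := by ring
    · intro t ht
      obtain ⟨htF, h1, h2⟩ := hGF t ht
      obtain ⟨⟨g1, -, g3, g4, g5, -⟩, -⟩ := hF t htF
      rw [hbX]
      exact ⟨g1, h1, h2, g3, by simpa using g4, g5⟩
  have hH0 : 0 ≤ ∑ i ∈ Finset.Icc 1 n, ((i : ℝ))⁻¹ := Finset.sum_nonneg fun _ _ => by positivity
  calc (F.card : ℝ) = ∑ p ∈ Finset.Icc 1 n ×ˢ Finset.Icc 1 n,
        ((F.filter (fun t => (t.2.2.2.2.toNat, t.2.2.1.toNat) = p)).card : ℝ) := by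
        rw [Finset.card_eq_sum_card_fiberwise hmem, Nat.cast_sum]
    _ ≤ ∑ p ∈ Finset.Icc 1 n ×ˢ Finset.Icc 1 n,
          12 * C₁ * (n : ℝ) ^ (4 * η) * E * ((p.1 : ℝ)⁻¹ * (p.2 : ℝ)⁻¹) := Finset.sum_le_sum hfib
    _ = 12 * C₁ * (n : ℝ) ^ (4 * η) * E * (∑ i ∈ Finset.Icc 1 n, ((i : ℝ))⁻¹) ^ 2 := by
        rw [← Finset.mul_sum, Finset.sum_product, sq, Finset.sum_mul_sum]
    _ ≤ 12 * C₁ * (n : ℝ) ^ (4 * η) * E * (C₂ * (n : ℝ) ^ η) ^ 2 := by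
        gcongr
        exact hC₂ n hn1
    _ = 12 * C₁ * C₂ ^ 2 * (n : ℝ) ^ (6 * η) * E := by
        have h : (n : ℝ) ^ (6 * η) = (n : ℝ) ^ (4 * η) * ((n : ℝ) ^ η) ^ 2 := by
          rw [sq, ← Real.rpow_add hn0, ← Real.rpow_add hn0]
          ring_nf
        rw [h]
        ring
    _ ≤ 12 * C₁ * C₂ ^ 2 * (v ^ 2) ^ (6 * η) * E := by
        gcongr
        exact Nat.floor_le (by positivity)

/-- `#𝒮^{(1)}(X,T) ≪ (XT)^ε (X^{3/4} + X^{5/12 + δ/2} T + X^{1/4 + δ} T² + X^{-1/12 + 3δ/2} T³)`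
for fixed `δ ∈ (0, 1)`, `ε > 0` and `c₀ > 0`. -/
theorem Sset1_count (δ ε c₀ : ℝ) (hδ : δ ∈ Set.Ioo (0 : ℝ) 1) (hε : 0 < ε) (hc₀ : 0 < c₀) :
    ∃ C : ℝ, 0 < C ∧ ∀ X T : ℝ, 1 ≤ X → 1 ≤ T →
      (Nat.card {t : ℤ × ℤ × ℤ × ℤ × ℤ // t ∈ Sset1 c₀ δ X T} : ℝ) ≤
        C * (X * T) ^ ε * (X ^ ((3 : ℝ) / 4) + X ^ (5 / 12 + δ / 2) * T +
          X ^ (1 / 4 + δ) * T ^ 2 + X ^ (-1 / 12 + 3 * δ / 2) * T ^ 3) := by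
  obtain ⟨C₁, hC₁0, hC₁⟩ := exists_card_divisors_le_rpow (ε / 12) (by positivity)
  obtain ⟨C₂, hC₂0, hC₂⟩ := exists_sum_inv_le_rpow (ε / 12) (by positivity)
  have hk0 : 0 < √c₀ := Real.sqrt_pos.mpr hc₀
  have hkk : √c₀ ^ 2 = c₀ := Real.sq_sqrt hc₀.le
  set k := √c₀ with hk
  set m := max 1 k with hm
  have hm1 : 1 ≤ m := le_max_left _ _
  have hkm : k ≤ m := le_max_right _ _
  refine ⟨12 * C₁ * C₂ ^ 2 * c₀ ^ (ε / 2) * m ^ 3, by positivity, fun X T hX hT => ?_⟩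
  have hX0 : 0 < X := by linarith
  have hT0 : 0 < T := by linarith
  have hpow : ∀ (r : ℝ) (j : ℕ), (X ^ r) ^ j = X ^ (r * j) := fun r j => by
    rw [Real.rpow_mul hX0.le, Real.rpow_natCast]
  set b : ℝ := X ^ ((1 : ℝ) / 12) with hb
  set v : ℝ := k * T * X ^ (δ / 2) with hv
  have hb0 : 0 < b := by positivity
  have hv0 : 0 < v := by positivity
  have hbX : b ^ 12 = X := by rw [hb, hpow]; norm_num
  have hbX' : b ^ 2 = X ^ ((1 : ℝ) / 6) := by rw [hb, hpow]; norm_num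
  have hvX : v ^ 2 = c₀ * T ^ 2 * X ^ δ := by
    rw [hv, mul_pow, mul_pow, hpow, hkk]
    congr 2
    push_cast
    ring
  have hv1 : (v ^ 2) ^ (6 * (ε / 12)) ≤ c₀ ^ (ε / 2) * (X * T) ^ ε := by
    have h1 : v ^ 2 ≤ c₀ * (X * T) ^ 2 := by
      have h2 : X ^ δ ≤ X ^ 2 := by
        rw [← Real.rpow_natCast]
        exact Real.rpow_le_rpow_of_exponent_le hX (by push_cast; linarith [hδ.2])
      calc v ^ 2 = c₀ * T ^ 2 * X ^ δ := hvX
        _ ≤ c₀ * T ^ 2 * X ^ 2 := by gcongr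
        _ = _ := by ring
    calc (v ^ 2) ^ (6 * (ε / 12)) ≤ (c₀ * (X * T) ^ 2) ^ (6 * (ε / 12)) := by gcongr
      _ = c₀ ^ (ε / 2) * (X * T) ^ ε := by
        rw [Real.mul_rpow hc₀.le (by positivity), ← Real.rpow_natCast (X * T),
          ← Real.rpow_mul (by positivity)]
        congr 2
        · ring
        · push_cast
          ring
  have hE : v ^ 3 / b + b ^ 3 * v ^ 2 + b ^ 5 * v + b ^ 9 ≤
      m ^ 3 * (X ^ ((3 : ℝ) / 4) + X ^ (5 / 12 + δ / 2) * T +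
          X ^ (1 / 4 + δ) * T ^ 2 + X ^ (-1 / 12 + 3 * δ / 2) * T ^ 3) := by
    have e1 : b ^ 9 = X ^ ((3 : ℝ) / 4) := by rw [hb, hpow]; norm_num
    have e2 : b ^ 5 * v = k * (X ^ (5 / 12 + δ / 2) * T) := by
      rw [hb, hv, hpow, Real.rpow_add hX0]
      norm_num
      ring
    have e3 : b ^ 3 * v ^ 2 = k ^ 2 * (X ^ (1 / 4 + δ) * T ^ 2) := by
      rw [hb, hvX, hpow, Real.rpow_add hX0, hkk]
      norm_num
      ring
    have e4 : v ^ 3 / b = k ^ 3 * (X ^ (-1 / 12 + 3 * δ / 2) * T ^ 3) := by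
      have h1 : X ^ (-1 / 12 + 3 * δ / 2) = (X ^ (δ / 2)) ^ 3 / b := by
        rw [hb, hpow, ← Real.rpow_sub hX0]
        congr 1
        push_cast
        ring
      rw [h1, hv]
      ring
    have k1 : k ≤ m ^ 3 := hkm.trans (le_self_pow₀ hm1 (by norm_num))
    have k2 : k ^ 2 ≤ m ^ 3 :=
      (pow_le_pow_left₀ hk0.le hkm 2).trans (pow_le_pow_right₀ hm1 (by norm_num))
    have k3 : k ^ 3 ≤ m ^ 3 := pow_le_pow_left₀ hk0.le hkm 3
    have k0 : 1 ≤ m ^ 3 := one_le_pow₀ hm1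
    rw [e1, e2, e3, e4]
    have f1 : X ^ ((3 : ℝ) / 4) ≤ m ^ 3 * X ^ ((3 : ℝ) / 4) :=
      le_mul_of_one_le_left (by positivity) k0
    have f2 : k * (X ^ (5 / 12 + δ / 2) * T) ≤ m ^ 3 * (X ^ (5 / 12 + δ / 2) * T) := by gcongr
    have f3 : k ^ 2 * (X ^ (1 / 4 + δ) * T ^ 2) ≤ m ^ 3 * (X ^ (1 / 4 + δ) * T ^ 2) := by gcongr
    have f4 : k ^ 3 * (X ^ (-1 / 12 + 3 * δ / 2) * T ^ 3) ≤
        m ^ 3 * (X ^ (-1 / 12 + 3 * δ / 2) * T ^ 3) := by gcongr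
    linarith
  have hfinal : ∀ F : Finset (ℤ × ℤ × ℤ × ℤ × ℤ), (∀ t ∈ F, t ∈ Sset1 c₀ δ X T) →
      (F.card : ℝ) ≤ 12 * C₁ * C₂ ^ 2 * c₀ ^ (ε / 2) * m ^ 3 * (X * T) ^ ε *
        (X ^ ((3 : ℝ) / 4) + X ^ (5 / 12 + δ / 2) * T +
          X ^ (1 / 4 + δ) * T ^ 2 + X ^ (-1 / 12 + 3 * δ / 2) * T ^ 3) := by
    intro F hF
    refine (card_le_of_subset_Sset1 hb0 hv0 (by positivity) hbX hbX' hvX hC₁0 hC₁ hC₂ F hF).trans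
      ((mul_le_mul (mul_le_mul_of_nonneg_left hv1 (by positivity)) hE (by positivity)
        (by positivity)).trans (le_of_eq ?_))
    ring
  by_cases hfin : (Sset1 c₀ δ X T).Finite
  · have h := hfinal hfin.toFinset fun t ht => hfin.mem_toFinset.mp ht
    rwa [← Set.ncard_eq_toFinset_card _ hfin] at h
  · have h : Nat.card {t : ℤ × ℤ × ℤ × ℤ × ℤ // t ∈ Sset1 c₀ δ X T} = 0 :=
      Set.Infinite.ncard hfin
    rw [h, Nat.cast_zero]
    positivity
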